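/- Fix β ∈ (0,1). Let B ⊆ {2,…,K} be nonempty, fix N_a ≥ 0 for a ∈ B̄^c, and fix I ≥ 0. Then there is a unique tuple (N_a ≥ 0 : a ∈ B̄) such that N_1 = β·Σ_{a∈[K]} N_a and W_a(N_1, N_a) = I for every a ∈ B. Moreover, setting N_{1,1} = β·Σ_{a∈B̄^c} N_a and N_{1,2} = I / min_{a∈B} d(μ_1, μ_a), the solution satisfies N_1 ≥ max{N_{1,1}, N_{1,2}}. -/

import Mathlib

open scoped BigOperators

/-- A single-parameter exponential family, given by the log-partition function `b`,
smooth with positive second derivative on an open interval `Θ`, together with the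
inverse `θof` of `b'` on the set of means `S = b'(Θ)`. -/
structure SPEF where
  Θ : Set ℝ
  Θ_isOpen : IsOpen Θ
  Θ_ordConnected : Set.OrdConnected Θ
  Θ_nonempty : Θ.Nonempty
  b : ℝ → ℝ
  b_smooth : ContDiffOn ℝ (⊤ : ℕ∞) b Θ
  b_conv : ∀ t ∈ Θ, 0 < iteratedDeriv 2 b t
  θof : ℝ → ℝ
  θof_mem : ∀ μ ∈ deriv b '' Θ, θof μ ∈ Θ
  θof_spec : ∀ μ ∈ deriv b '' Θ, deriv b (θof μ) = μ

namespace SPEF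

/-- The set of means of the family. -/
def S (F : SPEF) : Set ℝ := deriv F.b '' F.Θ

/-- KL divergence `d(μ, x)` between the members of the family with means `μ` and `x`. -/
noncomputable def d (F : SPEF) (μ x : ℝ) : ℝ :=
  (F.θof μ - F.θof x) * μ - F.b (F.θof μ) + F.b (F.θof x)

end SPEF

/-- A `K`-armed bandit instance with arm distributions in a fixed SPEF; arm `0`
(the paper's arm `1`) is the unique best arm. -/
structure Bandit (K : ℕ) [NeZero K] extends SPEF where
  two_le : 2 ≤ K
  μ : Fin K → ℝ
  μ_mem : ∀ a, μ a ∈ SPEF.S toSPEF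
  μ_best : ∀ a : Fin K, a ≠ 0 → μ a < μ 0

namespace Bandit

variable {K : ℕ} [NeZero K]

/-- KL divergence of the underlying family. -/
noncomputable def d (M : Bandit K) : ℝ → ℝ → ℝ := M.toSPEF.d

/-- The weighted mean `x_{1,a}(N₁, N_a)`. -/
noncomputable def x1 (M : Bandit K) (a : Fin K) (N1 Na : ℝ) : ℝ :=
  (N1 * M.μ 0 + Na * M.μ a) / (N1 + Na)

/-- The index `W_a(N₁, N_a)` of an arm `a ≠ 1`. -/
noncomputable def W (M : Bandit K) (a : Fin K) (N1 Na : ℝ) : ℝ :=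
  N1 * M.d (M.μ 0) (M.x1 a N1 Na) + Na * M.d (M.μ a) (M.x1 a N1 Na)

/-- The set `{2, …, K}` of suboptimal arms. -/
def alt (K : ℕ) [NeZero K] : Finset (Fin K) := Finset.univ.filter (fun a => a ≠ 0)

/-- The anchor function `g(μ, N)`. -/
noncomputable def g (M : Bandit K) (Nv : Fin K → ℝ) : ℝ :=
  (∑ a ∈ alt K, M.d (M.μ 0) (M.x1 a (Nv 0) (Nv a)) / M.d (M.μ a) (M.x1 a (Nv 0) (Nv a))) - 1

end Bandit

open Bandit

namespace SPEF

variable (F : SPEF)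

lemma differentiableAt_b {t : ℝ} (ht : t ∈ F.Θ) : DifferentiableAt ℝ F.b t :=
  ((F.b_smooth.differentiableOn (by simp)) t ht).differentiableAt (F.Θ_isOpen.mem_nhds ht)

lemma strictConvexOn_b : StrictConvexOn ℝ F.Θ F.b := by
  refine strictConvexOn_of_deriv2_pos' F.Θ_ordConnected.convex F.b_smooth.continuousOn ?_
  intro t ht
  rw [← iteratedDeriv_eq_iterate]
  exact F.b_conv t ht

lemma strictMonoOn_deriv_b : StrictMonoOn (deriv F.b) F.Θ :=
  F.strictConvexOn_b.strictMonoOn_deriv fun _ ht => F.differentiableAt_b ht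

lemma ordConnected_S : F.S.OrdConnected :=
  ((isPreconnected_iff_ordConnected.2 F.Θ_ordConnected).image _
    (F.b_smooth.continuousOn_deriv_of_isOpen F.Θ_isOpen (by simp))).ordConnected

lemma tangent_lt {s t : ℝ} (hs : s ∈ F.Θ) (ht : t ∈ F.Θ) (hst : s ≠ t) :
    0 < F.b s - F.b t - deriv F.b t * (s - t) := by
  rcases lt_or_gt_of_ne hst with h | h
  · have := F.strictConvexOn_b.slope_lt_deriv hs ht h (F.differentiableAt_b ht)
    rw [slope_def_field, div_lt_iff₀ (by linarith)] at this
    linarith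
  · have := F.strictConvexOn_b.deriv_lt_slope ht hs h (F.differentiableAt_b ht)
    rw [slope_def_field, lt_div_iff₀ (by linarith)] at this
    linarith

lemma d_self (m : ℝ) : F.d m m = 0 := by
  simp [d]

lemma d_pos {m x : ℝ} (hm : m ∈ F.S) (hx : x ∈ F.S) (hne : m ≠ x) : 0 < F.d m x := by
  have hθ : F.θof x ≠ F.θof m := fun h => hne <| by
    rw [← F.θof_spec m hm, ← F.θof_spec x hx, h]
  have := F.tangent_lt (F.θof_mem x hx) (F.θof_mem m hm) hθ
  rw [F.θof_spec m hm] at this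
  unfold d
  linarith

lemma d_nonneg {m x : ℝ} (hm : m ∈ F.S) (hx : x ∈ F.S) : 0 ≤ F.d m x := by
  rcases eq_or_ne m x with rfl | h
  · exact (F.d_self m).ge
  · exact (F.d_pos hm hx h).le

lemma θof_deriv {t : ℝ} (ht : t ∈ F.Θ) : F.θof (deriv F.b t) = t :=
  F.strictMonoOn_deriv_b.injOn (F.θof_mem _ ⟨t, ht, rfl⟩) ht (F.θof_spec _ ⟨t, ht, rfl⟩)

lemma θof_lt {q p : ℝ} (hq : q ∈ F.S) (hp : p ∈ F.S) (h : q < p) : F.θof q < F.θof p := by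
  rw [← F.strictMonoOn_deriv_b.lt_iff_lt (F.θof_mem q hq) (F.θof_mem p hp),
    F.θof_spec q hq, F.θof_spec p hp]
  exact h

/-- The divergence from `q` is monotone in its second argument on the right of `q`. -/
lemma d_le_d_right {q x p : ℝ} (hx : x ∈ F.S) (hp : p ∈ F.S)
    (hqx : q ≤ x) (hxp : x ≤ p) : F.d q x ≤ F.d q p := by
  have hθ : F.θof x ≤ F.θof p := by
    rcases hxp.eq_or_lt with rfl | h
    · exact le_rfl
    · exact (F.θof_lt hx hp h).le
  have h1 := F.d_nonneg hx hp
  have h2 := mul_nonneg (sub_nonneg.2 hqx) (sub_nonneg.2 hθ)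
  unfold d at *
  linarith

/-- Values of `d(p, ·)` at means slightly above `q` come arbitrarily close to `d(p, q)`. -/
lemma exists_lt_d {q p c : ℝ} (hq : q ∈ F.S) (hp : p ∈ F.S) (hqp : q < p) (hc : c < F.d p q) :
    ∃ x ∈ F.S, q < x ∧ x < p ∧ c < F.d p x := by
  have hΘq := F.θof_mem q hq
  have hΘp := F.θof_mem p hp
  have hcont : ContinuousAt
      (fun t => (F.θof p - t) * p - F.b (F.θof p) + F.b t) (F.θof q) := by
    have := (F.differentiableAt_b hΘq).continuousAt
    fun_prop
  have hev := (hcont.eventually (lt_mem_nhds hc)).filter_mono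
    (nhdsWithin_le_nhds (s := Set.Ioi (F.θof q)))
  obtain ⟨t, ht, htmem⟩ :=
    (hev.and (Ioo_mem_nhdsGT (F.θof_lt hq hp hqp))).exists
  have htΘ : t ∈ F.Θ := F.Θ_ordConnected.out hΘq hΘp ⟨htmem.1.le, htmem.2.le⟩
  refine ⟨deriv F.b t, ⟨t, htΘ, rfl⟩, ?_, ?_, ?_⟩
  · rw [← F.θof_spec q hq]
    exact F.strictMonoOn_deriv_b hΘq htΘ htmem.1
  · rw [← F.θof_spec p hp]
    exact F.strictMonoOn_deriv_b htΘ hΘp htmem.2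
  · rw [d, F.θof_deriv htΘ]
    exact ht

end SPEF

/-- A strictly monotone function has a continuous inverse on its image, if domain and image are
order-connected. -/
lemma StrictMonoOn.exists_continuousOn_inverse {f : ℝ → ℝ} {s t : Set ℝ} [s.OrdConnected]
    [t.OrdConnected] (hf : StrictMonoOn f s) (himg : f '' s = t) :
    ∃ g : ℝ → ℝ, ContinuousOn g t ∧ ∀ y ∈ t, g y ∈ s ∧ f (g y) = y := by
  classical
  subst himg
  set e := StrictMonoOn.orderIso f s hf
  refine ⟨fun y => if h : y ∈ f '' s then e.symm ⟨y, h⟩ else 0, ?_, ?_⟩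
  · rw [continuousOn_iff_continuous_domRestrict]
    have hc : Continuous fun y : f '' s => ((e.symm y : s) : ℝ) :=
      continuous_subtype_val.comp e.symm.continuous
    refine hc.congr fun y => ?_
    simp only [Set.domRestrict_apply, dif_pos y.2]
  · intro y hy
    simp only [dif_pos hy]
    exact ⟨(e.symm ⟨y, hy⟩).2, congrArg Subtype.val (e.apply_symm_apply ⟨y, hy⟩)⟩

namespace Bandit

variable {K : ℕ} [NeZero K] (M : Bandit K) {a : Fin K}

lemma x1_mem_Icc (ha : a ≠ 0) {N₁ N₂ : ℝ} (h₁ : 0 ≤ N₁) (h₂ : 0 ≤ N₂) (h : 0 < N₁ + N₂) :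
    M.x1 a N₁ N₂ ∈ Set.Icc (M.μ a) (M.μ 0) := by
  have hμ := M.μ_best a ha
  constructor
  · rw [x1, le_div_iff₀ h]
    nlinarith
  · rw [x1, div_le_iff₀ h]
    nlinarith

lemma x1_mem_S (ha : a ≠ 0) {N₁ N₂ : ℝ} (h₁ : 0 ≤ N₁) (h₂ : 0 ≤ N₂) (h : 0 < N₁ + N₂) :
    M.x1 a N₁ N₂ ∈ M.toSPEF.S :=
  M.toSPEF.ordConnected_S.out (M.μ_mem a) (M.μ_mem 0) (M.x1_mem_Icc ha h₁ h₂ h)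

/-- The weighted mean minimises the weighted sum of divergences. -/
lemma W_le (ha : a ≠ 0) {N₁ N₂ x : ℝ} (h₁ : 0 ≤ N₁) (h₂ : 0 ≤ N₂) (h : 0 < N₁ + N₂)
    (hx : x ∈ M.toSPEF.S) :
    M.W a N₁ N₂ ≤ N₁ * M.d (M.μ 0) x + N₂ * M.d (M.μ a) x := by
  have hd := mul_nonneg h.le (M.toSPEF.d_nonneg (M.x1_mem_S ha h₁ h₂ h) hx)
  have hmean : (N₁ + N₂) * M.x1 a N₁ N₂ = N₁ * M.μ 0 + N₂ * M.μ a := by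
    rw [x1]; field_simp
  unfold W d
  unfold SPEF.d at *
  linear_combination hd + (M.θof (M.x1 a N₁ N₂) - M.θof x) * hmean

lemma W_zero_left (N : ℝ) : M.W a 0 N = 0 := by
  rcases eq_or_ne N 0 with rfl | h
  · simp [W]
  · simp [W, x1, d, h, SPEF.d_self]

lemma W_zero_right (N : ℝ) : M.W a N 0 = 0 := by
  rcases eq_or_ne N 0 with rfl | h
  · simp [W]
  · simp [W, x1, d, h, SPEF.d_self]

lemma W_smul {c N₁ N₂ : ℝ} (hc : c ≠ 0) : M.W a (c * N₁) (c * N₂) = c * M.W a N₁ N₂ := by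
  have hx : M.x1 a (c * N₁) (c * N₂) = M.x1 a N₁ N₂ := by
    simp only [x1, mul_assoc, ← mul_add]
    exact mul_div_mul_left _ _ hc
  simp only [W, hx]
  ring

lemma W_mono_left (ha : a ≠ 0) {N₁ N₁' N₂ : ℝ} (h₁ : 0 < N₁) (hle : N₁ ≤ N₁') (h₂ : 0 ≤ N₂) :
    M.W a N₁ N₂ ≤ M.W a N₁' N₂ := by
  have hx := M.x1_mem_S ha (h₁.le.trans hle) h₂ (by linarith)
  refine (M.W_le ha h₁.le h₂ (by linarith) hx).trans ?_
  have := mul_le_mul_of_nonneg_right hle (M.toSPEF.d_nonneg (M.μ_mem 0) hx)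
  unfold W d
  linarith

lemma W_strictMonoOn_right (ha : a ≠ 0) {N₁ : ℝ} (h₁ : 0 < N₁) :
    StrictMonoOn (M.W a N₁) (Set.Ici 0) := by
  intro N₂ h₂ N₂' h₂' hlt
  rw [Set.mem_Ici] at h₂ h₂'
  have hx := M.x1_mem_S ha h₁.le h₂' (by linarith)
  have hne : M.μ a ≠ M.x1 a N₁ N₂' := by
    intro h
    have hs : N₁ + N₂' ≠ 0 := by linarith
    rw [x1, eq_div_iff hs] at h
    nlinarith [M.μ_best a ha]
  refine (M.W_le ha h₁.le h₂ (by linarith) hx).trans_lt ?_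
  have := mul_lt_mul_of_pos_right hlt (M.toSPEF.d_pos (M.μ_mem a) hx hne)
  unfold W d
  linarith

lemma W_le_mul_d (ha : a ≠ 0) {N₁ N₂ : ℝ} (h₁ : 0 ≤ N₁) (h₂ : 0 ≤ N₂) :
    M.W a N₁ N₂ ≤ N₁ * M.d (M.μ 0) (M.μ a) := by
  rcases h₁.eq_or_lt with rfl | h
  · simp [W_zero_left]
  · simpa [d, SPEF.d_self] using M.W_le ha h₁ h₂ (by linarith) (M.μ_mem a)

lemma continuousOn_W_one (ha : a ≠ 0) : ContinuousOn (M.W a 1) (Set.Ici 0) := by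
  have key : ∀ s ∈ Set.Ici (0 : ℝ), ∀ t ∈ Set.Ici (0 : ℝ),
      M.W a 1 t ≤ M.W a 1 s + M.d (M.μ a) (M.μ 0) * |t - s| := by
    intro s hs t ht
    rw [Set.mem_Ici] at hs ht
    have hx := M.x1_mem_S ha zero_le_one hs (by linarith)
    have hI := M.x1_mem_Icc ha zero_le_one hs (by linarith)
    have hd := M.toSPEF.d_le_d_right hx (M.μ_mem 0) hI.1 hI.2
    have hd0 := M.toSPEF.d_nonneg (M.μ_mem a) hx
    have hW := M.W_le ha zero_le_one ht (by linarith) hx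
    have h1 := mul_le_mul_of_nonneg_right (le_abs_self (t - s)) hd0
    have h2 := mul_le_mul_of_nonneg_left hd (abs_nonneg (t - s))
    unfold W d at *
    linarith
  have hD : 0 ≤ M.d (M.μ a) (M.μ 0) := M.toSPEF.d_nonneg (M.μ_mem a) (M.μ_mem 0)
  refine (LipschitzOnWith.of_le_add_mul (⟨_, hD⟩ : NNReal) fun t ht s hs => ?_).continuousOn
  exact key s hs t ht

lemma d_pos (ha : a ≠ 0) : 0 < M.d (M.μ 0) (M.μ a) :=
  M.toSPEF.d_pos (M.μ_mem 0) (M.μ_mem a) (M.μ_best a ha).ne'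

lemma W_one_image (ha : a ≠ 0) :
    M.W a 1 '' Set.Ici 0 = Set.Ico 0 (M.d (M.μ 0) (M.μ a)) := by
  have hmono := M.W_strictMonoOn_right ha one_pos
  apply Set.Subset.antisymm
  · rintro _ ⟨t, ht, rfl⟩
    rw [Set.mem_Ici] at ht
    constructor
    · rw [← M.W_zero_right (a := a) 1]
      exact hmono.monotoneOn Set.self_mem_Ici ht ht
    · refine (hmono ht (Set.mem_Ici.2 (by linarith)) (lt_add_one t)).trans_le ?_
      simpa using M.W_le_mul_d ha zero_le_one (show (0 : ℝ) ≤ t + 1 by linarith)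
  · rintro y ⟨hy0, hyD⟩
    obtain ⟨x, hxS, hx1, hx2, hyx⟩ :=
      M.toSPEF.exists_lt_d (M.μ_mem a) (M.μ_mem 0) (M.μ_best a ha) hyD
    set t := (M.μ 0 - x) / (x - M.μ a) with ht
    have hq : 0 < x - M.μ a := by linarith
    have ht0 : 0 ≤ t := div_nonneg (by linarith) hq.le
    have hxt : M.x1 a 1 t = x := by
      have h1 : t * (x - M.μ a) = M.μ 0 - x := by rw [ht]; field_simp
      rw [x1, div_eq_iff (by linarith)]
      linarith
    have hyt : y ≤ M.W a 1 t := by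
      have := mul_nonneg ht0 (M.toSPEF.d_nonneg (M.μ_mem a) hxS)
      unfold W d
      rw [hxt]
      linarith
    obtain ⟨s, hs, rfl⟩ := intermediate_value_Icc ht0
      ((M.continuousOn_W_one ha).mono Set.Icc_subset_Ici_self)
      ⟨(M.W_zero_right (a := a) 1).le.trans hy0, hyt⟩
    exact ⟨s, hs.1, rfl⟩

lemma W_one_exists_inverse (ha : a ≠ 0) :
    ∃ g : ℝ → ℝ, ContinuousOn g (Set.Ico 0 (M.d (M.μ 0) (M.μ a))) ∧
      ∀ y ∈ Set.Ico 0 (M.d (M.μ 0) (M.μ a)), 0 ≤ g y ∧ M.W a 1 (g y) = y :=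
  (M.W_strictMonoOn_right ha one_pos).exists_continuousOn_inverse (M.W_one_image ha)

/-- On a level set of the index, the count of arm `a` decreases as that of the best arm grows. -/
lemma le_of_W_eq (ha : a ≠ 0) {N₁ N₁' N₂ N₂' : ℝ} (h₁ : 0 < N₁) (hle : N₁ ≤ N₁')
    (h₂ : 0 ≤ N₂) (h₂' : 0 ≤ N₂') (h : M.W a N₁ N₂ = M.W a N₁' N₂') : N₂' ≤ N₂ := by
  by_contra! hlt
  have := M.W_strictMonoOn_right ha (h₁.trans_le hle) h₂ h₂' hlt
  linarith [M.W_mono_left ha h₁ hle h₂]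

/-- The allocations with index `I` on `B`, prescribed counts outside of `B` and a fraction `β` of
the total count on the best arm. -/
def IsAllocation (β : ℝ) (B : Finset (Fin K)) (Nout : Fin K → ℝ) (I : ℝ) (Nv : Fin K → ℝ) : Prop :=
  (0 ≤ Nv 0 ∧ ∀ a ∈ B, 0 ≤ Nv a) ∧ (∀ a ∈ alt K \ B, Nv a = Nout a) ∧
    Nv 0 = β * ∑ a, Nv a ∧ (∀ a ∈ B, M.W a (Nv 0) (Nv a) = I)

lemma ne_zero_of_mem {B : Finset (Fin K)} (hB : B ⊆ alt K) (ha : a ∈ B) : a ≠ 0 := by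
  simpa [alt] using hB ha

lemma sum_eq_add_add {B : Finset (Fin K)} (hB : B ⊆ alt K) (Nv : Fin K → ℝ) :
    ∑ a, Nv a = Nv 0 + (∑ a ∈ B, Nv a + ∑ a ∈ alt K \ B, Nv a) := by
  have h : alt K = Finset.univ.erase 0 := by
    ext a; simp [alt]
  rw [add_comm (∑ a ∈ B, Nv a), Finset.sum_sdiff hB, h, Finset.add_sum_erase _ _ (Finset.mem_univ 0)]

variable {M} {β I : ℝ} {B : Finset (Fin K)} {Nout : Fin K → ℝ}

namespace IsAllocation

variable {Nv Nv' : Fin K → ℝ}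

lemma balance (hB : B ⊆ alt K) (h : M.IsAllocation β B Nout I Nv) :
    (1 - β) * Nv 0 = β * (∑ a ∈ B, Nv a + ∑ a ∈ alt K \ B, Nout a) := by
  obtain ⟨-, hout, hsum, -⟩ := h
  rw [sum_eq_add_add hB, Finset.sum_congr rfl hout] at hsum
  linarith

lemma apply_zero_le (hβ : β ∈ Set.Ioo (0 : ℝ) 1) (hB : B ⊆ alt K)
    (h : M.IsAllocation β B Nout I Nv) (h' : M.IsAllocation β B Nout I Nv') (hpos : 0 < Nv 0) :
    Nv' 0 ≤ Nv 0 := by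
  by_contra! hlt
  have hle : ∑ a ∈ B, Nv' a ≤ ∑ a ∈ B, Nv a := Finset.sum_le_sum fun a ha =>
    M.le_of_W_eq (ne_zero_of_mem hB ha) hpos hlt.le (h.1.2 a ha) (h'.1.2 a ha)
      ((h.2.2.2 a ha).trans (h'.2.2.2 a ha).symm)
  have h1 := mul_le_mul_of_nonneg_left hle hβ.1.le
  have h2 := mul_lt_mul_of_pos_left hlt (sub_pos.2 hβ.2)
  linarith [h.balance hB, h'.balance hB]

lemma apply_zero_pos (hβ : β ∈ Set.Ioo (0 : ℝ) 1) (hBne : B.Nonempty) (hB : B ⊆ alt K)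
    (hNout : ∀ a ∈ alt K \ B, 0 ≤ Nout a)
    (h : M.IsAllocation β B Nout I Nv) (h' : M.IsAllocation β B Nout I Nv') (hpos : 0 < Nv 0) :
    0 < Nv' 0 := by
  refine h'.1.1.lt_of_ne' fun h0 => ?_
  have hsum := h'.balance hB
  have hBnn : 0 ≤ ∑ a ∈ B, Nv' a := Finset.sum_nonneg h'.1.2
  have hOnn := Finset.sum_nonneg hNout
  rw [h0, mul_zero, eq_comm, mul_eq_zero, or_iff_right hβ.1.ne'] at hsum
  obtain ⟨c, hc⟩ := hBne
  have hI : I = 0 := by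
    rw [← h'.2.2.2 c hc, h0, W_zero_left]
  have hzero : ∑ a ∈ B, Nv a = 0 := Finset.sum_eq_zero fun a ha =>
    (M.W_strictMonoOn_right (ne_zero_of_mem hB ha) hpos).injOn (h.1.2 a ha) Set.self_mem_Ici
      (by rw [h.2.2.2 a ha, hI, W_zero_right])
  have hbal := h.balance hB
  rw [hzero, show ∑ a ∈ alt K \ B, Nout a = 0 by linarith] at hbal
  have := mul_pos (sub_pos.2 hβ.2) hpos
  linarith

lemma unique (hβ : β ∈ Set.Ioo (0 : ℝ) 1) (hBne : B.Nonempty) (hB : B ⊆ alt K)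
    (hNout : ∀ a ∈ alt K \ B, 0 ≤ Nout a)
    (h : M.IsAllocation β B Nout I Nv) (h' : M.IsAllocation β B Nout I Nv') : Nv' = Nv := by
  have h0 : Nv' 0 = Nv 0 := by
    rcases h.1.1.eq_or_lt with hz | hpos
    · rcases h'.1.1.eq_or_lt with hz' | hpos'
      · rw [← hz, ← hz']
      · exact absurd hz (h'.apply_zero_pos hβ hBne hB hNout h hpos').ne
    · exact le_antisymm (h.apply_zero_le hβ hB h' hpos)
        (h'.apply_zero_le hβ hB h (h.apply_zero_pos hβ hBne hB hNout h' hpos))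
  funext a
  by_cases haB : a ∈ B
  · have ha := ne_zero_of_mem hB haB
    rcases h.1.1.eq_or_lt with hz | hpos
    · have hzero : ∀ N, M.IsAllocation β B Nout I N → N 0 = 0 → N a = 0 := by
        intro N hN hN0
        have hsum := hN.balance hB
        rw [hN0, mul_zero, eq_comm, mul_eq_zero, or_iff_right hβ.1.ne'] at hsum
        have := Finset.single_le_sum hN.1.2 haB
        linarith [hN.1.2 a haB, Finset.sum_nonneg hNout]
      rw [hzero Nv h hz.symm, hzero Nv' h' (h0.trans hz.symm)]
    · refine (M.W_strictMonoOn_right ha hpos).injOn (h'.1.2 a haB) (h.1.2 a haB) ?_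
      rw [h.2.2.2 a haB, ← h0, h'.2.2.2 a haB]
  · by_cases ha : a = 0
    · rw [ha, h0]
    · have hmem : a ∈ alt K \ B := by simp [alt, ha, haB]
      rw [h.2.1 a hmem, h'.2.1 a hmem]

lemma max_le (hβ : β ∈ Set.Ioo (0 : ℝ) 1) (hBne : B.Nonempty) (hB : B ⊆ alt K)
    (h : M.IsAllocation β B Nout I Nv) :
    max (β * ∑ a ∈ alt K \ B, Nout a)
      (I / B.inf' hBne fun a => M.d (M.μ 0) (M.μ a)) ≤ Nv 0 := by
  apply _root_.max_le
  · have h1 := mul_nonneg hβ.1.le (Finset.sum_nonneg h.1.2)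
    have h2 := mul_nonneg hβ.1.le h.1.1
    linarith [h.balance hB]
  · obtain ⟨c, hc, hmin⟩ := B.exists_mem_eq_inf' hBne fun a => M.d (M.μ 0) (M.μ a)
    have hc0 := ne_zero_of_mem hB hc
    rw [hmin, div_le_iff₀ (M.d_pos hc0), ← h.2.2.2 c hc]
    exact M.W_le_mul_d hc0 h.1.1 (h.1.2 c hc)

end IsAllocation

lemma exists_isAllocation_of_balance (hB : B ⊆ alt K) {N₁ : ℝ} {n : Fin K → ℝ} (h₁ : 0 ≤ N₁)
    (hn : ∀ a ∈ B, 0 ≤ n a)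
    (hbal : (1 - β) * N₁ = β * (∑ a ∈ B, n a + ∑ a ∈ alt K \ B, Nout a))
    (hW : ∀ a ∈ B, M.W a N₁ (n a) = I) : ∃ Nv, M.IsAllocation β B Nout I Nv := by
  classical
  set Nv : Fin K → ℝ := fun a => if a = 0 then N₁ else if a ∈ B then n a else Nout a
  have h0 : Nv 0 = N₁ := by simp [Nv]
  have hin : ∀ a ∈ B, Nv a = n a := fun a ha => by
    simp [Nv, ne_zero_of_mem hB ha, ha]
  have hout : ∀ a ∈ alt K \ B, Nv a = Nout a := fun a ha => by
    simp only [alt, Finset.mem_sdiff, Finset.mem_filter, Finset.mem_univ, true_and] at ha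
    simp [Nv, ha]
  refine ⟨Nv, ⟨h0 ▸ h₁, fun a ha => hin a ha ▸ hn a ha⟩, hout, ?_,
    fun a ha => by rw [h0, hin a ha, hW a ha]⟩
  rw [sum_eq_add_add hB, Finset.sum_congr rfl hout, Finset.sum_congr rfl hin, h0]
  linarith

lemma exists_isAllocation_of_pos (hβ : β ∈ Set.Ioo (0 : ℝ) 1) (hBne : B.Nonempty)
    (hB : B ⊆ alt K) (hNout : ∀ a ∈ alt K \ B, 0 ≤ Nout a) (hI : 0 < I) :
    ∃ Nv, M.IsAllocation β B Nout I Nv := by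
  have hβ' : 0 < 1 - β := sub_pos.2 hβ.2
  have hβ0 := hβ.1
  have hg : ∀ a : Fin K, ∃ g : ℝ → ℝ, a ∈ B →
      ContinuousOn g (Set.Ico 0 (M.d (M.μ 0) (M.μ a))) ∧
      ∀ y ∈ Set.Ico 0 (M.d (M.μ 0) (M.μ a)), 0 ≤ g y ∧ M.W a 1 (g y) = y := by
    intro a
    by_cases ha : a ∈ B
    · obtain ⟨g, hg⟩ := M.W_one_exists_inverse (ne_zero_of_mem hB ha)
      exact ⟨g, fun _ => hg⟩
    · exact ⟨0, fun h => absurd h ha⟩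
  choose g hgcont hg using hg
  obtain ⟨c, hc, hmin⟩ := B.exists_min_image (fun a => M.d (M.μ 0) (M.μ a)) hBne
  have hc0 := ne_zero_of_mem hB hc
  set r := (1 - β) / β with hr
  have hr0 : 0 < r := div_pos hβ' hβ0
  set y := M.W c 1 r with hy
  have hy0 : 0 < y := by
    rw [hy, ← M.W_zero_right (a := c) 1]
    exact M.W_strictMonoOn_right hc0 one_pos Set.self_mem_Ici hr0.le hr0
  have hyD : y < M.d (M.μ 0) (M.μ c) := by
    have : y ∈ M.W c 1 '' Set.Ici 0 := ⟨r, hr0.le, rfl⟩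
    rw [M.W_one_image hc0] at this
    exact this.2
  set L := I / y with hL
  have hL0 : 0 < L := div_pos hI hy0
  have hrange : ∀ N, L ≤ N → ∀ a ∈ B, I / N ∈ Set.Ico 0 (M.d (M.μ 0) (M.μ a)) := by
    intro N hN a ha
    have hN0 : 0 < N := hL0.trans_le hN
    refine ⟨(div_pos hI hN0).le, lt_of_le_of_lt ?_ (hyD.trans_le (hmin a ha))⟩
    rw [hL, div_le_iff₀ hy0] at hN
    rw [div_le_iff₀ hN0]
    linarith
  set n : Fin K → ℝ → ℝ := fun a N => N * g a (I / N) with hn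
  have hn0 : ∀ N, L ≤ N → ∀ a ∈ B, 0 ≤ n a N := fun N hN a ha =>
    mul_nonneg (hL0.le.trans hN) (hg a ha _ (hrange N hN a ha)).1
  have hnW : ∀ N, L ≤ N → ∀ a ∈ B, M.W a N (n a N) = I := by
    intro N hN a ha
    have hN0 : N ≠ 0 := (hL0.trans_le hN).ne'
    have := M.W_smul (a := a) (N₁ := 1) (N₂ := g a (I / N)) hN0
    rw [mul_one, (hg a ha _ (hrange N hN a ha)).2, mul_div_cancel₀ _ hN0] at this
    exact this
  set O := ∑ a ∈ alt K \ B, Nout a with hO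
  have hO0 : 0 ≤ O := Finset.sum_nonneg hNout
  set h : ℝ → ℝ := fun N => (1 - β) * N - β * (∑ a ∈ B, n a N + O) with hh
  set U := max L (β * (∑ a ∈ B, n a L + O) / (1 - β)) with hU
  have hcont : ContinuousOn h (Set.Icc L U) := by
    have hnc : ∀ a ∈ B, ContinuousOn (n a) (Set.Icc L U) := fun a ha =>
      continuousOn_id.mul ((hgcont a ha).comp
        (continuousOn_const.div continuousOn_id fun N hN => (hL0.trans_le hN.1).ne')
        fun N hN => hrange N hN.1 a ha)
    have := continuousOn_finsetSum B hnc
    fun_prop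
  have hlow : h L ≤ 0 := by
    have hgc : g c y = r :=
      (M.W_strictMonoOn_right hc0 one_pos).injOn (hg c hc y ⟨hy0.le, hyD⟩).1 hr0.le
        (hg c hc y ⟨hy0.le, hyD⟩).2
    have hnc : n c L = L * r := by
      have : I / L = y := by rw [hL]; field_simp
      simp only [hn, this, hgc]
    have hle := Finset.single_le_sum (hn0 L le_rfl) hc
    have h1 := mul_le_mul_of_nonneg_left hle hβ0.le
    have h2 : β * (L * r) = (1 - β) * L := by rw [hr]; field_simp
    have h3 := mul_nonneg hβ0.le hO0
    rw [hnc, h2] at h1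
    simp only [hh]
    linarith
  have hhigh : 0 ≤ h U := by
    have hLU : L ≤ U := le_max_left _ _
    have hle : ∑ a ∈ B, n a U ≤ ∑ a ∈ B, n a L := Finset.sum_le_sum fun a ha =>
      M.le_of_W_eq (ne_zero_of_mem hB ha) hL0 hLU (hn0 L le_rfl a ha) (hn0 U hLU a ha)
        ((hnW L le_rfl a ha).trans (hnW U hLU a ha).symm)
    have h1 := mul_le_mul_of_nonneg_left hle hβ0.le
    have h2 : β * (∑ a ∈ B, n a L + O) / (1 - β) ≤ U := le_max_right _ _
    rw [div_le_iff₀ hβ'] at h2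
    simp only [hh]
    linarith
  obtain ⟨N, hN, hzero⟩ := intermediate_value_Icc (le_max_left L _) hcont ⟨hlow, hhigh⟩
  exact exists_isAllocation_of_balance hB (hL0.le.trans hN.1) (hn0 N hN.1) (sub_eq_zero.1 hzero)
    (hnW N hN.1)

lemma exists_isAllocation (hβ : β ∈ Set.Ioo (0 : ℝ) 1) (hBne : B.Nonempty)
    (hB : B ⊆ alt K) (hNout : ∀ a ∈ alt K \ B, 0 ≤ Nout a) (hI : 0 ≤ I) :
    ∃ Nv, M.IsAllocation β B Nout I Nv := by
  rcases hI.eq_or_lt with rfl | hpos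
  · have hβ' : 0 < 1 - β := sub_pos.2 hβ.2
    refine exists_isAllocation_of_balance hB (n := 0)
      (N₁ := β * (∑ a ∈ alt K \ B, Nout a) / (1 - β))
      (div_nonneg (mul_nonneg hβ.1.le (Finset.sum_nonneg hNout)) hβ'.le) (by simp) ?_
      (fun a _ => M.W_zero_right _)
    simp only [Pi.zero_apply, Finset.sum_const_zero, zero_add]
    field_simp
  · exact exists_isAllocation_of_pos hβ hBne hB hNout hpos

end Bandit

/-- Lemma B.8, β-EB-TCB: existence and uniqueness of the allocation on
`B̄` with `N₁ = β·Σ_a N_a` and all indexes in `B` equal to `I`, together with the lower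
bound `N₁ ≥ max{N_{1,1}, N_{1,2}}`. -/
theorem statement_15 {K : ℕ} [NeZero K] (M : Bandit K)
    (β : ℝ) (hβ : β ∈ Set.Ioo (0 : ℝ) 1)
    (B : Finset (Fin K)) (hBne : B.Nonempty) (hBsub : B ⊆ alt K)
    (Nout : Fin K → ℝ) (hNout : ∀ a ∈ alt K \ B, 0 ≤ Nout a)
    (I : ℝ) (hI : 0 ≤ I) :
    ∃ Nv : Fin K → ℝ,
      -- existence
      ((0 ≤ Nv 0 ∧ ∀ a ∈ B, 0 ≤ Nv a) ∧ (∀ a ∈ alt K \ B, Nv a = Nout a) ∧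
        Nv 0 = β * ∑ a, Nv a ∧ (∀ a ∈ B, M.W a (Nv 0) (Nv a) = I)) ∧
      -- uniqueness
      (∀ Nv' : Fin K → ℝ,
        ((0 ≤ Nv' 0 ∧ ∀ a ∈ B, 0 ≤ Nv' a) ∧ (∀ a ∈ alt K \ B, Nv' a = Nout a) ∧
          Nv' 0 = β * ∑ a, Nv' a ∧ (∀ a ∈ B, M.W a (Nv' 0) (Nv' a) = I)) →
        Nv' = Nv) ∧
      -- lower bound on `N₁`
      max (β * ∑ a ∈ alt K \ B, Nout a)
          (I / B.inf' hBne fun a => M.d (M.μ 0) (M.μ a)) ≤ Nv 0 := by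
  obtain ⟨Nv, hNv⟩ := exists_isAllocation (M := M) hβ hBne hBsub hNout hI
  exact ⟨Nv, hNv, fun Nv' hNv' => IsAllocation.unique hβ hBne hBsub hNout hNv hNv',
    hNv.max_le hβ hBne hBsub⟩
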